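/- Let 1 ≤ d ≤ n be integers, H ⊂ ℝ^n a closed set, and C ⊂ C_H a family of smooth embeddings of S^{n−d} into ℝ^n ∖ H that is closed by isotopy with respect to H. Then the family F(H,C) of countably H^d-rectifiable C-spanning sets of H is a good class: for every K ∈ F(H,C), every x ∈ K, every r ∈ (0, dist(x,H)) and every φ ∈ D(x,r), the deformed set φ(K) is again a C-spanning set of H, and hence inf{H^d(J) : J ∈ F(H,C), J ∖ cl(B_{x,r}) = K ∖ cl(B_{x,r})} ≤ H^d(φ(K)). -/

import Mathlib

open MeasureTheory Metric Filter Set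
open scoped ENNReal NNReal Topology RealInnerProductSpace

noncomputable section

/-- Euclidean space `ℝ^n`. -/
abbrev Euc (n : ℕ) : Type := EuclideanSpace ℝ (Fin n)

/-- A set is countably `H^d`-rectifiable if, up to an `H^d`-negligible set, it can be
covered by countably many images of `C^1` maps from `ℝ^d`. -/
def CountablyRectifiable (d : ℕ) {n : ℕ} (K : Set (Euc n)) : Prop :=
  ∃ f : ℕ → (Euc d → Euc n), (∀ i, ContDiff ℝ 1 (f i)) ∧
    μH[(d : ℝ)] (K \ ⋃ i, Set.range (f i)) = 0

/-- A smooth diffeomorphism of `ℝ^n`. -/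
def IsDiffeo {n : ℕ} (f : Euc n → Euc n) : Prop :=
  ContDiff ℝ (⊤ : ℕ∞) f ∧ ∃ g : Euc n → Euc n, ContDiff ℝ (⊤ : ℕ∞) g ∧
    Function.LeftInverse g f ∧ Function.RightInverse g f

/-- The class `𝔇(x,r)`: maps equal to the identity outside `B(x,r)` which are smoothly
isotopic to the identity inside `B(x,r)`. -/
def IsotopyClass {n : ℕ} (x : Euc n) (r : ℝ) : Set (Euc n → Euc n) :=
  {φ | (∀ z ∉ ball x r, φ z = z) ∧
    ∃ lam : ℝ → Euc n → Euc n,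
      ContDiff ℝ (⊤ : ℕ∞) (fun p : ℝ × Euc n => lam p.1 p.2) ∧
      lam 0 = id ∧ lam 1 = φ ∧
      (∀ t ∈ Icc (0 : ℝ) 1, ∀ z ∉ ball x r, lam t z = z) ∧
      (∀ t ∈ Icc (0 : ℝ) 1, IsDiffeo (lam t))}

/-- The class `D(x,r)`: Lipschitz maps in the `C^0`-closure of `𝔇(x,r)`. -/
def DeformClass {n : ℕ} (x : Euc n) (r : ℝ) : Set (Euc n → Euc n) :=
  {φ | (∃ C : ℝ≥0, LipschitzWith C φ) ∧
    ∃ ψ : ℕ → (Euc n → Euc n), (∀ j, ψ j ∈ IsotopyClass x r) ∧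
      TendstoUniformly ψ φ atTop}

/-- `K` is relatively closed in `U`. -/
def RelClosedIn {n : ℕ} (U K : Set (Euc n)) : Prop :=
  K ⊆ U ∧ ∃ F : Set (Euc n), IsClosed F ∧ K = F ∩ U

/-- `inf { H^d(J) : J ∈ P, J ∖ cl B(x,r) = K ∖ cl B(x,r) }`. -/
def competInf (d : ℕ) {n : ℕ} (P : Set (Set (Euc n))) (K : Set (Euc n)) (x : Euc n)
    (r : ℝ) : ℝ≥0∞ :=
  sInf {m | ∃ J ∈ P, J \ closure (ball x r) = K \ closure (ball x r) ∧ m = μH[(d : ℝ)] J}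

/-- A family `P` is a good class (for boundary `H`). -/
def IsGoodClass (d : ℕ) {n : ℕ} (H : Set (Euc n)) (P : Set (Set (Euc n))) : Prop :=
  ∀ K ∈ P, ∀ x ∈ K, ∀ᵐ r ∂(volume : Measure ℝ),
    (0 < r ∧ ENNReal.ofReal r < EMetric.infEdist x H) →
      ∀ φ ∈ DeformClass x r, competInf d P K x r ≤ μH[(d : ℝ)] (φ '' K)

/-- The Plateau infimum `m₀ = inf {H^d(K) : K ∈ P}`. -/
def plateauInf (d : ℕ) {n : ℕ} (P : Set (Set (Euc n))) : ℝ≥0∞ := ⨅ K ∈ P, μH[(d : ℝ)] K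

/-- A minimizing sequence: `H^d(K_j) ↓ m₀`. -/
def IsMinimizingSeq (d : ℕ) {n : ℕ} (P : Set (Set (Euc n))) (Kj : ℕ → Set (Euc n)) : Prop :=
  (∀ j, Kj j ∈ P) ∧ Antitone (fun j => μH[(d : ℝ)] (Kj j)) ∧
    Tendsto (fun j => μH[(d : ℝ)] (Kj j)) atTop (𝓝 (plateauInf d P))

/-- The support of a measure. -/
def sptMeas {n : ℕ} (μ : Measure (Euc n)) : Set (Euc n) :=
  {x | ∀ r : ℝ, 0 < r → 0 < μ (ball x r)}

/-- Weak-* convergence of measures in the open set `U`. -/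
def WeakStarOn {n : ℕ} (U : Set (Euc n)) (μs : ℕ → Measure (Euc n)) (μ : Measure (Euc n)) :
    Prop :=
  ∀ f : Euc n → ℝ, Continuous f → HasCompactSupport f → tsupport f ⊆ U →
    Tendsto (fun j => ∫ z, f z ∂(μs j)) atTop (𝓝 (∫ z, f z ∂μ))

/-- The (multiplicity one) varifold associated to `K` is stationary in `U`: the first
variation of `H^d ⌐ K` along any compactly supported `C^1` vector field in `U` vanishes. -/
def StationaryIn (d : ℕ) {n : ℕ} (K U : Set (Euc n)) : Prop :=
  ∀ X : Euc n → Euc n, ContDiff ℝ 1 X → HasCompactSupport X → tsupport X ⊆ U →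
    HasDerivAt (fun t : ℝ => (μH[(d : ℝ)] ((fun z => z + t • X z) '' K)).toReal) 0 0

/-- `S` is a `d`-dimensional real analytic submanifold of `ℝ^n`. -/
def IsAnalyticSubmanifold (d : ℕ) {n : ℕ} (S : Set (Euc n)) : Prop :=
  ∀ x ∈ S, ∃ (U : Set (Euc n)) (V : Set (Euc d)) (f : Euc d → Euc n),
    IsOpen U ∧ x ∈ U ∧ IsOpen V ∧ AnalyticOnNhd ℝ f V ∧ Set.InjOn f V ∧
    (∀ y ∈ V, Function.Injective (fderiv ℝ f y)) ∧ f '' V = S ∩ U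

/-- `ω_d`, the Lebesgue measure of the unit ball of `ℝ^d`. -/
def ballVol (d : ℕ) : ℝ≥0∞ := volume (ball (0 : Euc d) 1)

/-- The `d`-dimensional density of `μ` at `x` is `θ`. -/
def HasDensityAt (d : ℕ) {n : ℕ} (μ : Measure (Euc n)) (x : Euc n) (θ : ℝ≥0∞) : Prop :=
  Tendsto (fun r : ℝ => μ (ball x r) / (ballVol d * ENNReal.ofReal r ^ d)) (𝓝[>] 0) (𝓝 θ)

/-- The blow-up `(K - x)/r`. -/
def blowup {n : ℕ} (x : Euc n) (r : ℝ) (K : Set (Euc n)) : Set (Euc n) :=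
  (fun y => r⁻¹ • (y - x)) '' K

/-- `π` is the approximate tangent plane of `K` at `x`: `π` is a `d`-dimensional subspace and
`H^d ⌐ (K-x)/r` converges weakly-* to `H^d ⌐ π` as `r → 0⁺`. -/
def HasApproxTangentPlane (d : ℕ) {n : ℕ} (K : Set (Euc n)) (x : Euc n) (π : Set (Euc n)) :
    Prop :=
  (∃ W : Submodule ℝ (Euc n), Module.finrank ℝ W = d ∧ π = (W : Set (Euc n))) ∧
  ∀ f : Euc n → ℝ, Continuous f → HasCompactSupport f →
    Tendsto (fun r : ℝ => ∫ z, f z ∂(μH[(d : ℝ)].restrict (blowup x r K))) (𝓝[>] 0)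
      (𝓝 (∫ z, f z ∂(μH[(d : ℝ)].restrict π)))

/-- The sphere `S^m`, realized as the unit sphere of `ℝ^{m+1}`. -/
def sph (m : ℕ) : Set (Euc (m + 1)) := sphere 0 1

/-- A smooth embedding of `S^{n-d}` into `ℝ^n ∖ H` (given by a smooth ambient map which is
injective and immersive on the sphere, with image avoiding `H`). -/
def IsEmbeddedSphere (n d : ℕ) (H : Set (Euc n)) (γ : Euc (n - d + 1) → Euc n) : Prop :=
  ContDiff ℝ (⊤ : ℕ∞) γ ∧ Set.InjOn γ (sph (n - d)) ∧
  (∀ y ∈ sph (n - d), ∀ v : Euc (n - d + 1), ⟪v, y⟫ = (0 : ℝ) → fderiv ℝ γ y v = 0 → v = 0) ∧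
  γ '' sph (n - d) ⊆ Hᶜ

/-- `γ` and `γ'` are smoothly isotopic embeddings of `S^{n-d}` in `ℝ^n ∖ H`. -/
def SphereIsotopic (n d : ℕ) (H : Set (Euc n)) (γ γ' : Euc (n - d + 1) → Euc n) : Prop :=
  ∃ Γ : ℝ → Euc (n - d + 1) → Euc n,
    ContDiff ℝ (⊤ : ℕ∞) (fun p : ℝ × Euc (n - d + 1) => Γ p.1 p.2) ∧
    Set.EqOn (Γ 0) γ (sph (n - d)) ∧ Set.EqOn (Γ 1) γ' (sph (n - d)) ∧
    ∀ t ∈ Icc (0 : ℝ) 1, IsEmbeddedSphere n d H (Γ t)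

/-- `C` is a family of smooth embeddings of `S^{n-d}` into `ℝ^n ∖ H` closed by isotopy. -/
def ClosedByIsotopy (n d : ℕ) (H : Set (Euc n)) (C : Set (Euc (n - d + 1) → Euc n)) : Prop :=
  (∀ γ ∈ C, IsEmbeddedSphere n d H γ) ∧
  ∀ γ ∈ C, ∀ γ' : Euc (n - d + 1) → Euc n,
    IsEmbeddedSphere n d H γ' → SphereIsotopic n d H γ γ' → γ' ∈ C

/-- `K` is a `C`-spanning set of `H`. -/
def IsSpanning (n d : ℕ) (C : Set (Euc (n - d + 1) → Euc n)) (K : Set (Euc n)) : Prop :=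
  ∀ γ ∈ C, (K ∩ γ '' sph (n - d)).Nonempty

/-- `F(H,C)`: the countably `H^d`-rectifiable relatively closed `C`-spanning sets of `H`. -/
def spanningClass (n d : ℕ) (H : Set (Euc n)) (C : Set (Euc (n - d + 1) → Euc n)) :
    Set (Set (Euc n)) :=
  {K | RelClosedIn Hᶜ K ∧ CountablyRectifiable d K ∧ IsSpanning n d C K}

/-- `Σ(H)`: Lipschitz maps homotopic to the identity through maps preserving `H`. -/
def SlidingMaps {n : ℕ} (H : Set (Euc n)) : Set (Euc n → Euc n) :=
  {φ | (∃ C : ℝ≥0, LipschitzWith C φ) ∧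
    ∃ Φ : ℝ → Euc n → Euc n, Continuous (fun p : ℝ × Euc n => Φ p.1 p.2) ∧
      Φ 0 = id ∧ Φ 1 = φ ∧ ∀ t ∈ Icc (0 : ℝ) 1, Φ t '' H ⊆ H}

/-- `A(H,K₀) = {φ(K₀) : φ ∈ Σ(H)}`. -/
def slidingClass {n : ℕ} (H K0 : Set (Euc n)) : Set (Set (Euc n)) :=
  {K | ∃ φ ∈ SlidingMaps H, K = φ '' K0}

/-- The cone competitor for `K` in `B(x,r)`. -/
def coneCompetitor {n : ℕ} (x : Euc n) (r : ℝ) (K : Set (Euc n)) : Set (Euc n) :=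
  (K \ ball x r) ∪
    {w | ∃ z ∈ K ∩ sphere x r, ∃ lam ∈ Icc (0 : ℝ) 1, w = lam • x + (1 - lam) • z}


section LusinApproximation

variable {E F : Type*} [NormedAddCommGroup E] [NormedSpace ℝ E] [FiniteDimensional ℝ E]
  [MeasurableSpace E] [BorelSpace E]
  [NormedAddCommGroup F] [NormedSpace ℝ F] [FiniteDimensional ℝ F]

/-- Convolution with an even bump function supported in the unit ball smooths a Lipschitz map
without increasing its Lipschitz constant, and is close to the map, together with its increments,
at every point near which the map is almost affine. -/
theorem exists_smoothing (μ : Measure E) [μ.IsAddHaarMeasure] :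
    ∃ c : ℝ, 0 ≤ c ∧ ∀ (K : ℝ≥0) (h : E → F), LipschitzWith K h →
      ∃ G : E → F, ContDiff ℝ 1 G ∧ LipschitzWith K G ∧
        ∀ (a : E) (L : E →L[ℝ] F) (ε : ℝ),
          (∀ x ∈ closedBall a 2, ‖h x - h a - L (x - a)‖ ≤ ε) →
          ‖G a - h a‖ ≤ ε ∧ ∀ b ∈ closedBall a 1, ‖G b - G a - L (b - a)‖ ≤ c * ε * ‖b - a‖ := by
  let bump : ContDiffBump (0 : E) := ⟨1 / 2, 1, by norm_num, by norm_num⟩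
  set η : E → ℝ := bump.normed μ with hη
  have hη_smooth : ContDiff ℝ 1 η := bump.contDiff_normed (n := 1)
  have hη_cont : Continuous η := hη_smooth.continuous
  have hη_supp : HasCompactSupport η := bump.hasCompactSupport_normed
  have hη_int : ∫ t, η t ∂μ = 1 := bump.integral_normed
  have hη_integrable : Integrable η μ := hη_cont.integrable_of_hasCompactSupport hη_supp
  have hη_nonneg : ∀ t, 0 ≤ η t := fun t => bump.nonneg_normed t
  have hη_neg : ∀ t, η (-t) = η t := fun t => bump.normed_neg t
  have hη_zero : ∀ t, 1 < ‖t‖ → η t = 0 := by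
    intro t ht
    have : t ∉ Function.support η := by
      rw [hη, bump.support_normed_eq]
      simpa [bump] using ht.le
    simpa using this
  obtain ⟨M, hM⟩ := ContDiff.lipschitzWith_of_hasCompactSupport hη_supp hη_smooth one_ne_zero
  have integrable_smul : ∀ f : E → F, Continuous f → Integrable (fun t => η t • f t) μ :=
    fun f hf => (hη_cont.smul hf).integrable_of_hasCompactSupport hη_supp.smul_right
  have norm_integral_le : ∀ (f : E → F) (ε : ℝ), (∀ t, ‖t‖ ≤ 1 → ‖f t‖ ≤ ε) →
      ‖∫ t, η t • f t ∂μ‖ ≤ ε := by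
    intro f ε hf
    have : ‖∫ t, η t • f t ∂μ‖ ≤ ∫ t, η t * ε ∂μ := by
      refine norm_integral_le_of_norm_le (hη_integrable.mul_const ε) (ae_of_all _ fun t => ?_)
      rw [norm_smul, Real.norm_of_nonneg (hη_nonneg t)]
      rcases le_or_gt ‖t‖ 1 with ht | ht
      · exact mul_le_mul_of_nonneg_left (hf t ht) (hη_nonneg t)
      · simp [hη_zero t ht]
    rwa [integral_mul_const, hη_int, one_mul] at this
  have integral_linear : ∀ L : E →L[ℝ] F, ∫ t, η t • L t ∂μ = 0 := by
    intro L
    have h1 : ∫ t, η t • L t ∂μ = -∫ t, η t • L t ∂μ := by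
      conv_lhs => rw [← integral_neg_eq_self]
      simp [hη_neg, integral_neg]
    have h2 : (2 : ℝ) • ∫ t, η t • L t ∂μ = 0 := by
      rw [two_smul]; nth_rewrite 1 [h1]; simp
    simpa using h2
  have integral_const_smul : ∀ v : F, ∫ t, η t • v ∂μ = v := by
    intro v
    rw [integral_smul_const, hη_int, one_smul]
  refine ⟨M * μ.real (closedBall 0 2), by positivity, fun K h hK => ?_⟩
  have hc := hK.continuous
  refine ⟨fun x => ∫ t, η t • h (x - t) ∂μ, ?_, ?_, ?_⟩
  · exact hη_supp.contDiff_convolution_left (n := 1) (ContinuousLinearMap.lsmul ℝ ℝ) hη_smooth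
      (hc.locallyIntegrable)
  · refine LipschitzWith.of_dist_le_mul fun x y => ?_
    rw [dist_eq_norm, ← integral_sub (integrable_smul _ (by fun_prop))
      (integrable_smul _ (by fun_prop))]
    simp_rw [← smul_sub]
    refine norm_integral_le _ _ fun t _ => ?_
    rw [← dist_eq_norm]
    simpa using hK.dist_le_mul (x - t) (y - t)
  intro a L ε hε
  set R : E → F := fun x => h x - h a - L (x - a) with hR
  have hRc : Continuous R := by fun_prop
  have mollify : ∀ x, (∫ t, η t • h (x - t) ∂μ) =
      (∫ t, η t • R (x - t) ∂μ) + h a + L (x - a) := by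
    intro x
    have : ∀ t, η t • h (x - t) =
        η t • R (x - t) + (η t • (h a + L (x - a)) - η t • L t) := by
      intro t
      simp only [hR, map_sub]
      module
    simp_rw [this]
    rw [integral_add (integrable_smul _ (by fun_prop)), integral_sub, integral_const_smul,
      integral_linear]
    · abel
    · exact integrable_smul _ (by fun_prop)
    · exact integrable_smul _ (by fun_prop)
    · exact (integrable_smul _ (by fun_prop)).sub (integrable_smul _ (by fun_prop))
  have mollify_swap : ∀ x, (∫ t, η t • R (x - t) ∂μ) = ∫ t, η (x - t) • R t ∂μ := by
    intro x
    rw [← integral_sub_left_eq_self _ μ x]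
    simp
  constructor
  · simp only [mollify, sub_self, map_zero, add_zero, add_sub_cancel_right]
    refine norm_integral_le _ _ fun t ht => hε _ ?_
    simp only [mem_closedBall, dist_eq_norm]
    calc ‖a - t - a‖ = ‖t‖ := by rw [sub_sub_cancel_left, norm_neg]
      _ ≤ 2 := by linarith
  · intro b hb
    have hba : ‖b - a‖ ≤ 1 := by simpa [dist_eq_norm] using hb
    have shifted_integrable : ∀ x, Integrable (fun t => η (x - t) • R t) μ := by
      intro x
      have := (integrable_smul (fun t => R (x - t)) (by fun_prop)).comp_sub_left x
      simpa using this
    have key : (∫ t, η t • h (b - t) ∂μ) - (∫ t, η t • h (a - t) ∂μ) - L (b - a) =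
        ∫ t, (η (b - t) - η (a - t)) • R t ∂μ := by
      rw [mollify, mollify, mollify_swap, mollify_swap]
      simp_rw [sub_smul]
      rw [integral_sub (shifted_integrable b) (shifted_integrable a)]
      simp only [sub_self, map_zero]
      abel
    rw [key, ← setIntegral_eq_integral_of_forall_compl_eq_zero (s := closedBall a 2)]
    · have hfin : μ (closedBall a 2) < ∞ := measure_closedBall_lt_top
      have : μ.real (closedBall a 2) = μ.real (closedBall (0 : E) 2) := by
        rw [measureReal_def, measureReal_def, Measure.addHaar_closedBall_center]
      calc _ ≤ (M * ‖b - a‖ * ε) * μ.real (closedBall a 2) := by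
            refine norm_setIntegral_le_of_norm_le_const hfin fun t ht => ?_
            rw [norm_smul]
            refine mul_le_mul ?_ (hε t ht) (norm_nonneg _) (by positivity)
            rw [← dist_eq_norm]
            simpa [dist_eq_norm] using hM.dist_le_mul (b - t) (a - t)
        _ = _ := by rw [this]; ring
    · intro t ht
      have hta : 2 < ‖t - a‖ := by simpa [dist_eq_norm] using ht
      have h1 : 1 < ‖a - t‖ := by rw [norm_sub_rev]; linarith
      have h2 : 1 < ‖b - t‖ := by
        have := norm_sub_le_norm_sub_add_norm_sub t b a
        rw [norm_sub_rev t b] at this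
        linarith
      rw [hη_zero _ h1, hη_zero _ h2, sub_zero, zero_smul]

omit [MeasurableSpace E] [BorelSpace E] [FiniteDimensional ℝ E] [FiniteDimensional ℝ F] in
theorem setOf_affine_approx_eq_dense {f : E → F} (hf : Continuous f) {Q : Set E} (hQ : Dense Q)
    (e r : ℝ) :
    {a | ∀ v ∈ ball (0 : E) r, ‖f (a + v) - f a - fderiv ℝ f a v‖ ≤ e * ‖v‖} =
      {a | ∀ v ∈ ball (0 : E) r ∩ Q, ‖f (a + v) - f a - fderiv ℝ f a v‖ ≤ e * ‖v‖} := by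
  ext a
  refine ⟨fun h v hv => h v hv.1, fun h v hv => ?_⟩
  have hcl : IsClosed {v : E | ‖f (a + v) - f a - fderiv ℝ f a v‖ ≤ e * ‖v‖} :=
    isClosed_le (by fun_prop) (by fun_prop)
  exact closure_minimal (fun v hv => h v hv) hcl (hQ.open_subset_closure_inter isOpen_ball hv)

theorem measurableSet_affine_approx {f : E → F} (hf : Continuous f) (e r : ℝ) :
    MeasurableSet
      {a | ∀ v ∈ ball (0 : E) r, ‖f (a + v) - f a - fderiv ℝ f a v‖ ≤ e * ‖v‖} := by
  obtain ⟨Q, hQc, hQd⟩ := TopologicalSpace.exists_countable_dense E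
  rw [setOf_affine_approx_eq_dense hf hQd]
  have : {a | ∀ v ∈ ball (0 : E) r ∩ Q, ‖f (a + v) - f a - fderiv ℝ f a v‖ ≤ e * ‖v‖} =
      ⋂ v ∈ ball (0 : E) r ∩ Q, {a | ‖f (a + v) - f a - fderiv ℝ f a v‖ ≤ e * ‖v‖} := by
    ext a
    simp only [mem_ofPred_eq, mem_iInter]
  rw [this]
  refine MeasurableSet.biInter (hQc.mono inter_subset_right) fun v _ => ?_
  borelize F
  refine measurableSet_le (Measurable.norm ?_) measurable_const
  have h1 : Measurable fun a => f (a + v) - f a := by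
    have : Continuous fun a => f (a + v) - f a := by fun_prop
    exact this.measurable
  have := FiniteDimensional.proper ℝ F
  have := FiniteDimensional.complete ℝ F
  exact h1.sub (measurable_fderiv_apply_const ℝ f v)

/-- A Lipschitz map is almost affine at a uniform scale outside a set of small measure. -/
theorem exists_uniform_affine_approx (μ : Measure E) [μ.IsAddHaarMeasure] {K : ℝ≥0} {f : E → F}
    (hf : LipschitzWith K f) {S : Set E} (hS : MeasurableSet S) (hSfin : μ S ≠ ∞)
    {e : ℝ} (he : 0 < e) {δ : ℝ≥0∞} (hδ : 0 < δ) :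
    ∃ r : ℝ, 0 < r ∧ ∃ A : Set E, MeasurableSet A ∧ μ (S \ A) < δ ∧
      ∀ a ∈ A, ∀ v ∈ ball (0 : E) r, ‖f (a + v) - f a - fderiv ℝ f a v‖ ≤ e * ‖v‖ := by
  set T : ℕ → Set E := fun m => {a | ∀ v ∈ ball (0 : E) (1 / ((m : ℝ) + 1)),
    ‖f (a + v) - f a - fderiv ℝ f a v‖ ≤ e * ‖v‖} with hT
  have hTm : ∀ m, MeasurableSet (T m) := fun m => measurableSet_affine_approx hf.continuous _ _
  have hmono : Monotone T := by
    intro m k hmk a ha v hv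
    exact ha v (ball_subset_ball (Nat.one_div_le_one_div hmk) hv)
  have hdiff : ∀ a, DifferentiableAt ℝ f a → ∃ m, a ∈ T m := by
    intro a ha
    have h1 := (hasFDerivAt_iff_isLittleO_nhds_zero.1 ha.hasFDerivAt).def he
    obtain ⟨s, hs, hsub⟩ := Metric.eventually_nhds_iff.1 h1
    obtain ⟨m, hm⟩ := exists_nat_one_div_lt hs
    refine ⟨m, fun v hv => hsub ?_⟩
    exact (mem_ball.1 hv).trans hm
  have hnull : μ (⋂ m, S \ T m) = 0 := by
    refine measure_mono_null (fun a ha => ?_) (ae_iff.1 (hf.ae_differentiableAt (μ := μ)))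
    intro hda
    obtain ⟨m, hm⟩ := hdiff a hda
    exact (mem_iInter.1 ha m).2 hm
  have hlim : Tendsto (fun m => μ (S \ T m)) atTop (𝓝 0) := by
    rw [← hnull]
    refine tendsto_measure_iInter_atTop (fun m => (hS.diff (hTm m)).nullMeasurableSet)
      (fun m k hmk => sdiff_subset_sdiff_right (hmono hmk)) ⟨0, ?_⟩
    exact ne_top_of_le_ne_top hSfin (measure_mono sdiff_subset)
  obtain ⟨m, hm⟩ := (hlim.eventually_lt_const hδ).exists
  exact ⟨1 / ((m : ℝ) + 1), by positivity, T m, hTm m, hm, fun a ha => ha⟩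

/-- Outside a set of small measure, a Lipschitz map is the sum of a `C^1` map with the same
Lipschitz constant and a map with small Lipschitz constant. -/
theorem exists_contDiff_add_small_lipschitz (μ : Measure E) [μ.IsAddHaarMeasure] {K : ℝ≥0}
    {f : E → F} (hf : LipschitzWith K f) {S : Set E} (hS : MeasurableSet S) (hSfin : μ S ≠ ∞)
    {ε : ℝ≥0} (hε : 0 < ε) {δ : ℝ≥0∞} (hδ : 0 < δ) :
    ∃ (g f' : E → F) (A : Set E), ContDiff ℝ 1 g ∧ LipschitzWith K g ∧ LipschitzWith ε f' ∧
      MeasurableSet A ∧ μ (S \ A) < δ ∧ ∀ a ∈ A, f a = g a + f' a := by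
  obtain ⟨c, hc, smoothing⟩ := exists_smoothing (E := E) (F := F) μ
  have hl : 0 < lipschitzExtensionConstant F := lipschitzExtensionConstant_pos F
  set ε' : ℝ≥0 := ε / lipschitzExtensionConstant F with hε'
  have hε'pos : 0 < ε' := by positivity
  set e : ℝ := ε' / (2 * c + 4) with he
  have hepos : 0 < e := by positivity
  have hecε : (2 * c + 4) * e = ε' := by rw [he]; field_simp
  obtain ⟨r, hr, A, hA, hSA, happrox⟩ := exists_uniform_affine_approx μ hf hS hSfin hepos hδ
  set ρ : ℝ := r / 4 with hρ
  have hρpos : 0 < ρ := by positivity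
  have hρinv : ρ * ρ⁻¹ = 1 := mul_inv_cancel₀ hρpos.ne'
  have rescale : ∀ k : E → F, LipschitzWith K k → ∀ s : ℝ, s ≠ 0 →
      LipschitzWith K (fun x => s⁻¹ • k (s • x)) := by
    intro k hk s hs
    refine LipschitzWith.of_dist_le_mul fun x y => ?_
    rw [dist_smul₀, norm_inv]
    have := hk.dist_le_mul (s • x) (s • y)
    rw [dist_smul₀] at this
    have hs' : 0 < ‖s‖ := norm_pos_iff.2 hs
    rw [inv_mul_le_iff₀ hs']
    linarith
  obtain ⟨G, hG, hGlip, hGapprox⟩ := smoothing K _ (rescale f hf ρ hρpos.ne')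
  set g : E → F := fun x => ρ • G (ρ⁻¹ • x) with hg
  have hglip : LipschitzWith K g := by
    simpa [hg] using rescale G hGlip ρ⁻¹ (inv_ne_zero hρpos.ne')
  have hgc : ContDiff ℝ 1 g := by fun_prop
  have close : ∀ a ∈ A, ‖g a - f a‖ ≤ 2 * e * ρ ∧
      ∀ b, ‖b - a‖ ≤ ρ → ‖g b - g a - fderiv ℝ f a (b - a)‖ ≤ c * (2 * e) * ‖b - a‖ := by
    intro a ha
    obtain ⟨h1, h2⟩ := hGapprox (ρ⁻¹ • a) (fderiv ℝ f a) (2 * e) (by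
      intro x hx
      obtain ⟨v, hv⟩ : ∃ v, v = x - ρ⁻¹ • a := ⟨_, rfl⟩
      rw [← hv]
      have hvn : ‖v‖ ≤ 2 := by simpa [dist_eq_norm, ← hv] using hx
      have hρx : ρ • x = a + ρ • v := by
        rw [hv, smul_sub, smul_smul, hρinv, one_smul]; abel
      have hρv : ‖ρ • v‖ ≤ 2 * ρ := by
        rw [norm_smul, Real.norm_of_nonneg hρpos.le]; nlinarith
      have := happrox a ha (ρ • v) (by
        rw [mem_ball_zero_iff]; linarith)
      rw [smul_smul ρ, hρinv, one_smul, hρx]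
      calc ‖ρ⁻¹ • f (a + ρ • v) - ρ⁻¹ • f a - fderiv ℝ f a v‖
          = ‖ρ⁻¹ • (f (a + ρ • v) - f a - fderiv ℝ f a (ρ • v))‖ := by
            rw [map_smul, smul_sub, smul_sub, smul_smul ρ⁻¹ ρ, inv_mul_cancel₀ hρpos.ne', one_smul]
        _ ≤ ρ⁻¹ * (e * (2 * ρ)) := by
            rw [norm_smul, norm_inv, Real.norm_of_nonneg hρpos.le]
            gcongr
            exact this.trans (by gcongr)
        _ = 2 * e := by field_simp)
    constructor
    · have : g a - f a = ρ • (G (ρ⁻¹ • a) - ρ⁻¹ • f (ρ • ρ⁻¹ • a)) := by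
        rw [smul_sub, smul_smul ρ ρ⁻¹ a, smul_smul, hρinv, one_smul, one_smul]
      rw [this, norm_smul, Real.norm_of_nonneg hρpos.le]
      nlinarith
    · intro b hb
      have hba : ‖ρ⁻¹ • b - ρ⁻¹ • a‖ = ρ⁻¹ * ‖b - a‖ := by
        rw [← smul_sub, norm_smul, norm_inv, Real.norm_of_nonneg hρpos.le]
      have h3 := h2 (ρ⁻¹ • b) (by
        rw [mem_closedBall, dist_eq_norm, hba, inv_mul_le_iff₀ hρpos]; linarith)
      have : g b - g a - fderiv ℝ f a (b - a) =
          ρ • (G (ρ⁻¹ • b) - G (ρ⁻¹ • a) - fderiv ℝ f a (ρ⁻¹ • b - ρ⁻¹ • a)) := by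
        rw [← smul_sub ρ⁻¹, map_smul, smul_sub ρ, smul_sub ρ, smul_smul ρ ρ⁻¹, hρinv, one_smul]
      rw [this, norm_smul, Real.norm_of_nonneg hρpos.le]
      rw [hba] at h3
      calc _ ≤ ρ * (c * (2 * e) * (ρ⁻¹ * ‖b - a‖)) := by gcongr
        _ = (ρ * ρ⁻¹) * (c * (2 * e) * ‖b - a‖) := by ring
        _ = _ := by rw [hρinv, one_mul]
  have hlipA : LipschitzOnWith ε' (fun x => f x - g x) A := by
    refine LipschitzOnWith.of_dist_le_mul fun b hb a ha => ?_
    rw [dist_eq_norm, dist_eq_norm, ← hecε]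
    rcases le_or_gt ‖b - a‖ ρ with hba | hba
    · have h1 := (close a ha).2 b hba
      have h2 := happrox a ha (b - a) (by rw [mem_ball_zero_iff]; linarith)
      rw [add_sub_cancel] at h2
      calc ‖f b - g b - (f a - g a)‖
          = ‖(f b - f a - fderiv ℝ f a (b - a)) - (g b - g a - fderiv ℝ f a (b - a))‖ := by
            congr 1; abel
        _ ≤ e * ‖b - a‖ + c * (2 * e) * ‖b - a‖ := (norm_sub_le _ _).trans (add_le_add h2 h1)
        _ ≤ (2 * c + 4) * e * ‖b - a‖ := by nlinarith [mul_nonneg hepos.le (norm_nonneg (b - a))]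
    · have h1 := (close a ha).1
      have h2 := (close b hb).1
      calc ‖f b - g b - (f a - g a)‖ = ‖(g a - f a) - (g b - f b)‖ := by congr 1; abel
        _ ≤ 2 * e * ρ + 2 * e * ρ := (norm_sub_le _ _).trans (add_le_add h1 h2)
        _ ≤ 4 * e * ‖b - a‖ := by nlinarith
        _ ≤ (2 * c + 4) * e * ‖b - a‖ := by
            gcongr; linarith
  obtain ⟨f', hf', heq⟩ := hlipA.extend_finite_dimension
  have hconst : lipschitzExtensionConstant F * ε' = ε := by
    rw [hε']; field_simp
  refine ⟨g, f', A, hgc, hglip, hconst ▸ hf', hA, hSA, fun a ha => ?_⟩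
  have := heq ha
  simp only at this
  rw [← this]; abel

/-- **Lusin property of Lipschitz maps, normalized at the origin.** -/
theorem exists_contDiff_eq_of_map_zero (μ : Measure E) [μ.IsAddHaarMeasure] {K : ℝ≥0}
    {f : E → F} (hf : LipschitzWith K f) (hf0 : f 0 = 0) {S : Set E} (hS : MeasurableSet S)
    (hSfin : μ S ≠ ∞) {δ : ℝ≥0∞} (hδ : 0 < δ) :
    ∃ g : E → F, ContDiff ℝ 1 g ∧ μ (S \ {x | f x = g x}) < δ := by
  set ε : ℕ → ℝ≥0 := fun k => (K + 1) * (1 / 2) ^ k with hε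
  have hεpos : ∀ k, 0 < ε k := fun k => by positivity
  have hεsum : Summable fun k => (ε k : ℝ) := by
    simp only [hε, NNReal.coe_mul, NNReal.coe_pow]
    refine Summable.mul_left _ (summable_geometric_of_lt_one (by positivity) ?_)
    norm_num
  obtain ⟨δ', hδ'pos, hδ'sum⟩ := ENNReal.exists_pos_sum_of_countable' hδ.ne' ℕ
  have step : ∀ (k : ℕ) (h : E → F), ∃ (g h' : E → F) (A : Set E),
      LipschitzWith (ε k) h → ContDiff ℝ 1 g ∧ LipschitzWith (ε k) g ∧
        (LipschitzWith (ε (k + 1)) h' ∧ h' 0 = 0) ∧ μ (S \ A) < δ' k ∧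
        ∀ a ∈ A, h a = g a + h' a := by
    intro k h
    by_cases hh : LipschitzWith (ε k) h
    · obtain ⟨g, h', A, hg, hgl, hl', -, hA, heq⟩ :=
        exists_contDiff_add_small_lipschitz μ hh hS hSfin (hεpos (k + 1)) (hδ'pos k)
      refine ⟨fun x => g x + h' 0, fun x => h' x - h' 0, A, fun _ =>
        ⟨hg.add contDiff_const, ?_, ⟨?_, sub_self _⟩, hA, fun a ha => ?_⟩⟩
      · exact LipschitzWith.of_dist_le_mul fun x y => by simpa using hgl.dist_le_mul x y
      · exact LipschitzWith.of_dist_le_mul fun x y => by simpa using hl'.dist_le_mul x y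
      · change h a = g a + h' 0 + (h' a - h' 0)
        rw [heq a ha]; abel
    · exact ⟨0, 0, ∅, fun h' => absurd h' hh⟩
  choose G N A hstep using step
  let fs : ℕ → E → F := fun k => Nat.rec f (fun k h => N k h) k
  have fs_succ : ∀ k, fs (k + 1) = N k (fs k) := fun k => rfl
  have hfs : ∀ k, LipschitzWith (ε k) (fs k) ∧ fs k 0 = 0 := by
    intro k
    induction k with
    | zero => exact ⟨hf.weaken (by simp [hε]), hf0⟩
    | succ k ih => exact (hstep k (fs k) ih.1).2.2.1
  set g : ℕ → E → F := fun k => G k (fs k) with hg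
  have hgc : ∀ k, ContDiff ℝ 1 (g k) := fun k => (hstep k (fs k) (hfs k).1).1
  have hgl : ∀ k, LipschitzWith (ε k) (g k) := fun k => (hstep k (fs k) (hfs k).1).2.1
  set B : Set E := ⋂ k, A k (fs k) with hB
  have hdec : ∀ x ∈ B, ∀ k, fs k x = g k x + fs (k + 1) x := fun x hx k =>
    (hstep k (fs k) (hfs k).1).2.2.2.2 x (mem_iInter.1 hx k)
  have hbound : ∀ k x, ‖fs k x‖ ≤ ε k * ‖x‖ := fun k x => by
    simpa [(hfs k).2] using (hfs k).1.dist_le_mul x 0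
  have hsmall : μ (S \ B) < δ := by
    rw [hB, sdiff_iInter]
    calc μ (⋃ k, S \ A k (fs k)) ≤ ∑' k, μ (S \ A k (fs k)) := measure_iUnion_le _
      _ ≤ ∑' k, δ' k := ENNReal.tsum_le_tsum fun k => (hstep k (fs k) (hfs k).1).2.2.2.1.le
      _ < δ := hδ'sum
  have hsummable : ∀ x ∈ B, Summable fun k => g k x := by
    intro x hx
    refine Summable.of_norm_bounded (g := fun k => (ε k : ℝ) * ‖x‖ + ε (k + 1) * ‖x‖)
      ((hεsum.mul_right _).add (((summable_nat_add_iff 1).2 hεsum).mul_right _)) fun k => ?_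
    rw [eq_sub_of_add_eq (hdec x hx k).symm]
    exact (norm_sub_le _ _).trans (add_le_add (hbound k x) (hbound (k + 1) x))
  have hpartial : ∀ x ∈ B, ∀ n, ∑ k ∈ Finset.range n, g k x = f x - fs n x := by
    intro x hx n
    induction n with
    | zero => simp [fs]
    | succ n ih => rw [Finset.sum_range_succ, ih, hdec x hx n]; abel
  have hfs_lim : ∀ x, Tendsto (fun n => fs n x) atTop (𝓝 0) := by
    intro x
    refine squeeze_zero_norm (hbound · x) ?_
    simpa using hεsum.tendsto_atTop_zero.mul_const ‖x‖
  have htsum : ∀ x ∈ B, f x = ∑' k, g k x := by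
    intro x hx
    have h1 := (hsummable x hx).hasSum.tendsto_sum_nat
    simp_rw [hpartial x hx] at h1
    have h2 : Tendsto (fun n => f x - fs n x) atTop (𝓝 (f x)) := by
      simpa using (hfs_lim x).const_sub (f x)
    exact tendsto_nhds_unique h2 h1
  rcases B.eq_empty_or_nonempty with hBe | ⟨x₀, hx₀⟩
  · refine ⟨0, contDiff_const, lt_of_le_of_lt (measure_mono ?_) hsmall⟩
    rw [hBe]
    exact sdiff_subset_sdiff_right (empty_subset _)
  refine ⟨fun x => ∑' k, g k x, ?_, lt_of_le_of_lt (measure_mono ?_) hsmall⟩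
  · have := FiniteDimensional.complete ℝ F
    have hderiv : ∀ x, HasFDerivAt (fun y => ∑' k, g k y) (∑' k, fderiv ℝ (g k) x) x :=
      hasFDerivAt_tsum hεsum
        (fun k x => ((hgc k).differentiable one_ne_zero x).hasFDerivAt)
        (fun k x => norm_fderiv_le_of_lipschitz ℝ (hgl k)) (hsummable x₀ hx₀)
    refine contDiff_one_iff_fderiv.2 ⟨fun x => (hderiv x).differentiableAt, ?_⟩
    have : fderiv ℝ (fun y => ∑' k, g k y) = fun x => ∑' k, fderiv ℝ (g k) x :=
      funext fun x => (hderiv x).fderiv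
    rw [this]
    exact continuous_tsum (fun k => (hgc k).continuous_fderiv one_ne_zero) hεsum
      fun k x => norm_fderiv_le_of_lipschitz ℝ (hgl k)
  · exact sdiff_subset_sdiff_right fun x hx => htsum x hx

/-- **Lusin property of Lipschitz maps.** A Lipschitz map coincides with a `C^1` map outside a set
of small measure. -/
theorem exists_contDiff_eq (μ : Measure E) [μ.IsAddHaarMeasure] {K : ℝ≥0}
    {f : E → F} (hf : LipschitzWith K f) {S : Set E} (hS : MeasurableSet S)
    (hSfin : μ S ≠ ∞) {δ : ℝ≥0∞} (hδ : 0 < δ) :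
    ∃ g : E → F, ContDiff ℝ 1 g ∧ μ (S \ {x | f x = g x}) < δ := by
  have hlip : LipschitzWith K fun x => f x - f 0 :=
    LipschitzWith.of_dist_le_mul fun x y => by simpa using hf.dist_le_mul x y
  obtain ⟨g, hg, hgS⟩ := exists_contDiff_eq_of_map_zero μ hlip (sub_self _) hS hSfin hδ
  refine ⟨fun x => g x + f 0, hg.add contDiff_const, ?_⟩
  simpa [sub_eq_iff_eq_add] using hgS

/-- A Lipschitz map on a set of finite measure is covered, up to a null set of points, by countably
many `C^1` maps. -/
theorem exists_seq_contDiff_ae_eq (μ : Measure E) [μ.IsAddHaarMeasure] {K : ℝ≥0}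
    {f : E → F} (hf : LipschitzWith K f) {S : Set E} (hS : MeasurableSet S) (hSfin : μ S ≠ ∞) :
    ∃ g : ℕ → E → F, (∀ k, ContDiff ℝ 1 (g k)) ∧ μ (S \ ⋃ k, {x | f x = g k x}) = 0 := by
  obtain ⟨δ, -, hδpos, hδlim⟩ := exists_seq_strictAnti_tendsto' (ENNReal.zero_lt_top)
  choose g hg hgS using fun k => exists_contDiff_eq μ hf hS hSfin (hδpos k).1
  refine ⟨g, hg, le_antisymm (ge_of_tendsto' hδlim fun k => ?_) zero_le⟩
  exact (measure_mono (sdiff_subset_sdiff_right (subset_iUnion _ k))).trans (hgS k).le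

end LusinApproximation

section Rectifiability

/-- The image under a Lipschitz map of a `C^1` image of `ℝ^d` is countably rectifiable. -/
theorem countablyRectifiable_image_range {d n : ℕ} {K : ℝ≥0} {φ : Euc n → Euc n}
    (hφ : LipschitzWith K φ) {f : Euc d → Euc n} (hf : ContDiff ℝ 1 f) :
    CountablyRectifiable d (φ '' range f) := by
  have hhaar : (μH[(d : ℝ)] : Measure (Euc d)).IsAddHaarMeasure := by
    simpa using isAddHaarMeasure_hausdorffMeasure (E := Euc d)
  have local_cover : ∀ N : ℕ, ∃ g : ℕ → Euc d → Euc n, (∀ k, ContDiff ℝ 1 (g k)) ∧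
      μH[(d : ℝ)] ((φ ∘ f) '' closedBall 0 N \ ⋃ k, range (g k)) = 0 := by
    intro N
    obtain ⟨M, hM⟩ := (hf.contDiffOn (s := closedBall 0 (N : ℝ))).exists_lipschitzOnWith
      one_ne_zero (convex_closedBall _ _) (isCompact_closedBall _ _)
    obtain ⟨h, hh, heq⟩ := (hφ.comp_lipschitzOnWith hM).extend_finite_dimension
    obtain ⟨g, hg, hnull⟩ := exists_seq_contDiff_ae_eq μH[(d : ℝ)] hh
      (isClosed_closedBall (x := (0 : Euc d)) (ε := N)).measurableSet
      measure_closedBall_lt_top.ne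
    refine ⟨g, hg, measure_mono_null (t := h '' (closedBall 0 N \ ⋃ k, {x | h x = g k x})) ?_ ?_⟩
    · rintro _ ⟨⟨x, hx, rfl⟩, hxg⟩
      refine ⟨x, ⟨hx, fun hxU => hxg ?_⟩, (heq hx).symm⟩
      obtain ⟨k, hk⟩ := mem_iUnion.1 hxU
      exact mem_iUnion.2 ⟨k, x, by rw [← mem_ofPred_eq.mp hk, ← heq hx]⟩
    · refine le_antisymm ((hh.hausdorffMeasure_image_le d.cast_nonneg _).trans ?_) zero_le
      rw [hnull, mul_zero]
  choose g hg hnull using local_cover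
  refine ⟨fun i => g i.unpair.1 i.unpair.2, fun i => hg _ _, ?_⟩
  refine measure_mono_null ?_ (measure_iUnion_null hnull)
  rintro _ ⟨⟨_, ⟨x, rfl⟩, rfl⟩, hx⟩
  obtain ⟨N, hN⟩ := exists_nat_ge ‖x‖
  refine mem_iUnion.2 ⟨N, ⟨x, by simpa using hN, rfl⟩, fun hU => hx ?_⟩
  obtain ⟨k, hk⟩ := mem_iUnion.1 hU
  exact mem_iUnion.2 ⟨Nat.pair N k, by simpa using hk⟩

theorem CountablyRectifiable.image {d n : ℕ} {K : Set (Euc n)} (hK : CountablyRectifiable d K)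
    {M : ℝ≥0} {φ : Euc n → Euc n} (hφ : LipschitzWith M φ) :
    CountablyRectifiable d (φ '' K) := by
  obtain ⟨f, hf, hnull⟩ := hK
  choose g hg hgnull using fun i => countablyRectifiable_image_range hφ (hf i)
  refine ⟨fun i => g i.unpair.1 i.unpair.2, fun i => hg _ _, ?_⟩
  have hnull' : μH[(d : ℝ)] (φ '' (K \ ⋃ i, range (f i))) = 0 := by
    refine le_antisymm ((hφ.hausdorffMeasure_image_le d.cast_nonneg _).trans ?_) zero_le
    rw [hnull, mul_zero]
  refine measure_mono_null ?_ (measure_union_null hnull' (measure_iUnion_null hgnull))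
  rintro _ ⟨⟨z, hz, rfl⟩, hx⟩
  by_cases hzf : z ∈ ⋃ i, range (f i)
  · obtain ⟨i, hi⟩ := mem_iUnion.1 hzf
    refine Or.inr (mem_iUnion.2 ⟨i, mem_image_of_mem φ hi, fun hU => hx ?_⟩)
    obtain ⟨k, hk⟩ := mem_iUnion.1 hU
    exact mem_iUnion.2 ⟨Nat.pair i k, by simpa using hk⟩
  · exact Or.inl ⟨z, ⟨hz, hzf⟩, rfl⟩

end Rectifiability

section Isotopy

theorem isDiffeo_fderiv_injective {n : ℕ} {f : Euc n → Euc n} (hf : IsDiffeo f) (z : Euc n) :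
    Function.Injective (fderiv ℝ f z) := by
  obtain ⟨hfs, g, hg, hgf, -⟩ := hf
  have hd : (fderiv ℝ g (f z)).comp (fderiv ℝ f z) = ContinuousLinearMap.id ℝ (Euc n) := by
    rw [← fderiv_comp z (hg.differentiable (by simp) _) (hfs.differentiable (by simp) _),
      hgf.comp_eq_id, fderiv_id]
  intro v w hvw
  simpa [hvw] using (DFunLike.congr_fun hd v).symm.trans
    ((congrArg (fderiv ℝ g (f z)) hvw).trans (DFunLike.congr_fun hd w))

/-- A smooth bijection with everywhere injective derivative has a smooth inverse. -/
theorem contDiff_symm_of_fderiv_injective {E : Type*} [NormedAddCommGroup E] [NormedSpace ℝ E]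
    [FiniteDimensional ℝ E] (e : E ≃ E) (he : ContDiff ℝ (⊤ : ℕ∞) e)
    (hinj : ∀ p, Function.Injective (fderiv ℝ e p)) : ContDiff ℝ (⊤ : ℕ∞) e.symm := by
  have := FiniteDimensional.complete ℝ E
  let D : E → E ≃L[ℝ] E := fun p =>
    (LinearEquiv.ofInjectiveEndo (fderiv ℝ e p : E →ₗ[ℝ] E) (hinj p)).toContinuousLinearEquiv
  have hD : ∀ p, (D p : E →L[ℝ] E) = fderiv ℝ e p := fun p => by ext v; rfl
  have hopen : IsOpenMap e := isOpenMap_iff_nhds_le.2 fun p => by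
    have h := he.contDiffAt (x := p) |>.hasStrictFDerivAt (by simp)
    rw [← hD p] at h
    exact h.map_nhds_eq_of_equiv.ge
  refine (e.toHomeomorphOfContinuousOpen he.continuous hopen).contDiff_symm (f₀' := D)
    (fun p => ?_) he
  rw [hD p]
  exact (he.differentiable (by simp) p).hasFDerivAt

/-- A smooth family of diffeomorphisms has a smooth family of inverses. -/
theorem exists_smooth_inverse_family {n : ℕ} {lam : ℝ → Euc n → Euc n}
    (hlam : ContDiff ℝ (⊤ : ℕ∞) fun p : ℝ × Euc n => lam p.1 p.2)
    (hdiffeo : ∀ t, IsDiffeo (lam t)) :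
    ∃ inv : ℝ → Euc n → Euc n, ContDiff ℝ (⊤ : ℕ∞) (fun p : ℝ × Euc n => inv p.1 p.2) ∧
      ∀ t, Function.LeftInverse (inv t) (lam t) ∧ Function.RightInverse (inv t) (lam t) := by
  choose g _ hgl hgr using fun t => (hdiffeo t).2
  let e : ℝ × Euc n ≃ ℝ × Euc n :=
    { toFun := fun p => (p.1, lam p.1 p.2)
      invFun := fun p => (p.1, g p.1 p.2)
      left_inv := fun p => Prod.ext rfl (hgl p.1 p.2)
      right_inv := fun p => Prod.ext rfl (hgr p.1 p.2) }
  have he : ContDiff ℝ (⊤ : ℕ∞) e := contDiff_fst.prodMk hlam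
  refine ⟨g, contDiff_snd.comp (contDiff_symm_of_fderiv_injective e he fun p => ?_),
    fun t => ⟨hgl t, hgr t⟩⟩
  have hL := (hlam.differentiable (by simp) p).hasFDerivAt
  have hd : fderiv ℝ e p = (ContinuousLinearMap.fst ℝ ℝ (Euc n)).prod
      (fderiv ℝ (fun p : ℝ × Euc n => lam p.1 p.2) p) :=
    (hasFDerivAt_fst.prodMk hL).fderiv
  have hslice : ∀ v, fderiv ℝ (fun p : ℝ × Euc n => lam p.1 p.2) p (0, v) =
      fderiv ℝ (lam p.1) p.2 v := by
    intro v
    have h1 : HasFDerivAt (lam p.1)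
        ((fderiv ℝ (fun p : ℝ × Euc n => lam p.1 p.2) p).comp
          (ContinuousLinearMap.inr ℝ ℝ (Euc n))) p.2 :=
      HasFDerivAt.comp p.2 (f := fun z => (p.1, z)) hL (hasFDerivAt_prodMk_right p.1 p.2)
    rw [h1.fderiv]; simp
  rw [hd]
  refine (injective_iff_map_eq_zero _).2 fun ⟨s, v⟩ hsv => ?_
  obtain ⟨hs, hv⟩ := Prod.ext_iff.1 hsv
  obtain rfl : s = 0 := hs
  have hv0 : fderiv ℝ (lam p.1) p.2 v = 0 := (hslice v).symm.trans hv
  have : v = 0 := isDiffeo_fderiv_injective (hdiffeo p.1) p.2 (by rw [hv0, map_zero])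
  rw [this]; rfl

theorem IsEmbeddedSphere.comp_inverse {n d : ℕ} {H : Set (Euc n)} {γ : Euc (n - d + 1) → Euc n}
    (hγ : IsEmbeddedSphere n d H γ) {f g : Euc n → Euc n} (hf : ContDiff ℝ (⊤ : ℕ∞) f)
    (hg : ContDiff ℝ (⊤ : ℕ∞) g) (hfg : Function.RightInverse g f) (hfH : ∀ z ∈ H, f z = z) :
    IsEmbeddedSphere n d H (g ∘ γ) := by
  obtain ⟨hs, hinj, himm, hH⟩ := hγ
  have hgγ : ContDiff ℝ (⊤ : ℕ∞) (g ∘ γ) := hg.comp hs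
  refine ⟨hgγ, hfg.injective.comp_injOn hinj, fun y hy v hvy hv => himm y hy v hvy ?_, ?_⟩
  · have hcomp : f ∘ (g ∘ γ) = γ := funext fun y => hfg (γ y)
    rw [← hcomp, fderiv_comp y (hf.differentiable (by simp) _) (hgγ.differentiable (by simp) _)]
    simp [hv]
  · rintro _ ⟨y, hy, rfl⟩ hyH
    refine hH ⟨y, hy, rfl⟩ ?_
    have := hfH _ hyH
    rw [Function.comp_apply, hfg] at this
    rw [this]
    exact hyH

/-- Pulling back a sphere by the end map of an isotopy fixing `H` stays in the isotopy class. -/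
theorem exists_pullback_mem {n d : ℕ} {H : Set (Euc n)} {C : Set (Euc (n - d + 1) → Euc n)}
    (hC : ClosedByIsotopy n d H C) {x : Euc n} {r : ℝ} (hHr : Disjoint (ball x r) H)
    {ψ : Euc n → Euc n} (hψ : ψ ∈ IsotopyClass x r) {γ : Euc (n - d + 1) → Euc n} (hγ : γ ∈ C) :
    ∃ γ' ∈ C, ∀ y, ψ (γ' y) = γ y := by
  obtain ⟨-, lam, hlam, hlam0, hlam1, hfix, hdiffeo⟩ := hψ
  set θ : ℝ → ℝ := Real.smoothTransition
  have hθ : ∀ t, θ t ∈ Icc (0 : ℝ) 1 := fun t =>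
    ⟨Real.smoothTransition.nonneg t, Real.smoothTransition.le_one t⟩
  have hθ0 : θ 0 = 0 := Real.smoothTransition.zero
  have hθ1 : θ 1 = 1 := Real.smoothTransition.one
  have hθs : ContDiff ℝ (⊤ : ℕ∞) θ := Real.smoothTransition.contDiff
  have hlamθ : ContDiff ℝ (⊤ : ℕ∞) fun p : ℝ × Euc n => lam (θ p.1) p.2 :=
    hlam.comp ((hθs.comp contDiff_fst).prodMk contDiff_snd)
  obtain ⟨inv, hinv, hinv'⟩ := exists_smooth_inverse_family hlamθ fun t => hdiffeo _ (hθ t)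
  have hγe := hC.1 γ hγ
  have hemb : ∀ t, IsEmbeddedSphere n d H (inv t ∘ γ) := fun t =>
    hγe.comp_inverse (hdiffeo _ (hθ t)).1 (hinv.comp (contDiff_const.prodMk contDiff_id))
      (hinv' t).2 fun z hz => hfix _ (hθ t) z (hHr.notMem_of_mem_right hz)
  refine ⟨inv 1 ∘ γ, hC.2 γ hγ _ (hemb 1) ⟨fun t => inv t ∘ γ, ?_, fun y _ => ?_,
    fun y _ => rfl, fun t _ => hemb t⟩, fun y => ?_⟩
  · exact hinv.comp (contDiff_fst.prodMk (hγe.1.comp contDiff_snd))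
  · have := (hinv' 0).2 (γ y)
    rwa [hθ0, hlam0] at this
  · have := (hinv' 1).2 (γ y)
    rwa [hθ1, hlam1] at this

theorem IsotopyClass.mem_ball {n : ℕ} {x : Euc n} {r : ℝ} {ψ : Euc n → Euc n}
    (hψ : ψ ∈ IsotopyClass x r) {z : Euc n} (hz : z ∈ ball x r) : ψ z ∈ ball x r := by
  obtain ⟨hfix, lam, -, -, rfl, -, hdiffeo⟩ := hψ
  obtain ⟨-, g, -, hg, -⟩ := hdiffeo 1 ⟨zero_le_one, le_rfl⟩
  by_contra h
  exact h (by rwa [hg.injective (hfix _ h)])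

theorem DeformClass.eq_self {n : ℕ} {x : Euc n} {r : ℝ} {φ : Euc n → Euc n}
    (hφ : φ ∈ DeformClass x r) {z : Euc n} (hz : z ∉ ball x r) : φ z = z := by
  obtain ⟨-, ψ, hψ, hlim⟩ := hφ
  refine tendsto_nhds_unique (hlim.tendsto_at z) ?_
  simp [(hψ _).1 z hz]

theorem DeformClass.mem_closedBall {n : ℕ} {x : Euc n} {r : ℝ} {φ : Euc n → Euc n}
    (hφ : φ ∈ DeformClass x r) {z : Euc n} (hz : z ∈ closedBall x r) : φ z ∈ closedBall x r := by
  by_cases hzb : z ∈ ball x r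
  · obtain ⟨-, ψ, hψ, hlim⟩ := hφ
    exact isClosed_closedBall.mem_of_tendsto (hlim.tendsto_at z)
      (Eventually.of_forall fun j => ball_subset_closedBall (IsotopyClass.mem_ball (hψ j) hzb))
  · rwa [DeformClass.eq_self hφ hzb]

variable {n : ℕ} {H K : Set (Euc n)} {x : Euc n} {r : ℝ} {φ : Euc n → Euc n}

theorem RelClosedIn.image_deform (hK : RelClosedIn Hᶜ K) (hHr : Disjoint (closedBall x r) H)
    (hφ : φ ∈ DeformClass x r) : RelClosedIn Hᶜ (φ '' K) := by
  obtain ⟨_, F, hF, rfl⟩ := hK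
  obtain ⟨M, hM⟩ := hφ.1
  have hcompact : IsCompact (F ∩ closedBall x r) := (isCompact_closedBall x r).inter_left hF
  have heq : φ '' (F ∩ Hᶜ) = (F \ ball x r ∪ φ '' (F ∩ closedBall x r)) ∩ Hᶜ := by
    ext w
    constructor
    · rintro ⟨z, ⟨hzF, hzH⟩, rfl⟩
      by_cases hz : z ∈ ball x r
      · have hz' := ball_subset_closedBall hz
        exact ⟨Or.inr ⟨z, ⟨hzF, hz'⟩, rfl⟩,
          hHr.notMem_of_mem_left (DeformClass.mem_closedBall hφ hz')⟩
      · rw [DeformClass.eq_self hφ hz]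
        exact ⟨Or.inl ⟨hzF, hz⟩, hzH⟩
    · rintro ⟨⟨hwF, hw⟩ | ⟨z, ⟨hzF, hz⟩, rfl⟩, hwH⟩
      · exact ⟨w, ⟨hwF, hwH⟩, DeformClass.eq_self hφ hw⟩
      · exact ⟨z, ⟨hzF, hHr.notMem_of_mem_left hz⟩, rfl⟩
  exact ⟨heq ▸ inter_subset_right, _,
    (hF.sdiff isOpen_ball).union (hcompact.image hM.continuous).isClosed, heq⟩

theorem image_deform_diff (hφ : φ ∈ DeformClass x r) :
    (φ '' K) \ closedBall x r = K \ closedBall x r := by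
  ext w
  constructor
  · rintro ⟨⟨z, hz, rfl⟩, hw⟩
    have hzb : z ∉ closedBall x r := fun h => hw (DeformClass.mem_closedBall hφ h)
    rw [DeformClass.eq_self hφ fun h => hzb (ball_subset_closedBall h)]
    exact ⟨hz, hzb⟩
  · rintro ⟨hw, hwb⟩
    exact ⟨⟨w, hw, DeformClass.eq_self hφ fun h => hwb (ball_subset_closedBall h)⟩, hwb⟩

theorem IsSpanning.image_deform {d : ℕ} {C : Set (Euc (n - d + 1) → Euc n)}
    (hC : ClosedByIsotopy n d H C) (hKcl : RelClosedIn Hᶜ K) (hK : IsSpanning n d C K)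
    (hHr : Disjoint (closedBall x r) H) (hφ : φ ∈ DeformClass x r) :
    IsSpanning n d C (φ '' K) := by
  intro γ hγ
  by_contra hempty
  have hγe := hC.1 γ hγ
  obtain ⟨-, F, hF, hFeq⟩ := hKcl.image_deform hHr hφ
  have hcompact : IsCompact (γ '' sph (n - d)) := (isCompact_sphere 0 1).image hγe.1.continuous
  have hdisj : Disjoint (γ '' sph (n - d)) F := by
    rw [Set.disjoint_left]
    intro w hw hwF
    exact hempty ⟨w, hFeq ▸ ⟨hwF, hγe.2.2.2 hw⟩, hw⟩
  obtain ⟨ε, hε, hsep⟩ := hdisj.exists_thickenings hcompact hF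
  obtain ⟨-, ψ, hψ, hlim⟩ := hφ
  obtain ⟨j, hj⟩ := (Metric.tendstoUniformly_iff.1 hlim ε hε).exists
  obtain ⟨γ', hγ', hγψ⟩ := exists_pullback_mem hC (hHr.mono_left ball_subset_closedBall) (hψ j) hγ
  obtain ⟨_, hzK, y, hy, rfl⟩ := hK γ' hγ'
  have hφF : φ (γ' y) ∈ F := (hFeq ▸ mem_image_of_mem φ hzK : φ (γ' y) ∈ F ∩ Hᶜ).1
  have hdist := hj (γ' y)
  rw [hγψ] at hdist
  have hmem : φ (γ' y) ∈ thickening ε (γ '' sph (n - d)) :=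
    mem_thickening_iff.2 ⟨γ y, mem_image_of_mem γ hy, hdist⟩
  exact Set.disjoint_left.1 hsep hmem (self_subset_thickening hε _ hφF)

theorem disjoint_closedBall_of_lt_infEDist (h : ENNReal.ofReal r < Metric.infEDist x H) :
    Disjoint (closedBall x r) H := by
  rw [Set.disjoint_left]
  intro z hz hzH
  refine (h.trans_le (Metric.infEDist_le_edist_of_mem hzH)).not_ge ?_
  rw [edist_comm, edist_dist]
  exact ENNReal.ofReal_le_ofReal hz

end Isotopy

/-- **Theorem 2(a).** If `C` is closed by isotopy with respect to `H`, then `F(H,C)` is a good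
class; indeed for every `K ∈ F(H,C)`, `x ∈ K`, `r ∈ (0, dist(x,H))` and `φ ∈ D(x,r)`, the set
`φ(K)` is again a `C`-spanning set of `H`, whence
`inf {H^d(J) : J ∈ F(H,C), J ∖ cl B(x,r) = K ∖ cl B(x,r)} ≤ H^d(φ(K))`. -/
theorem statement1 {n d : ℕ} (hd1 : 1 ≤ d) (hdn : d ≤ n)
    (H : Set (Euc n)) (hH : IsClosed H)
    (C : Set (Euc (n - d + 1) → Euc n)) (hC : ClosedByIsotopy n d H C) :
    IsGoodClass d H (spanningClass n d H C) ∧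
    ∀ K ∈ spanningClass n d H C, ∀ x ∈ K, ∀ r : ℝ,
      0 < r → ENNReal.ofReal r < EMetric.infEdist x H →
      ∀ φ ∈ DeformClass x r,
        IsSpanning n d C (φ '' K) ∧
        competInf d (spanningClass n d H C) K x r ≤ μH[(d : ℝ)] (φ '' K) := by
  have main : ∀ K ∈ spanningClass n d H C, ∀ x ∈ K, ∀ r : ℝ,
      0 < r → ENNReal.ofReal r < EMetric.infEdist x H → ∀ φ ∈ DeformClass x r,
        IsSpanning n d C (φ '' K) ∧
        competInf d (spanningClass n d H C) K x r ≤ μH[(d : ℝ)] (φ '' K) := by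
    intro K ⟨hKcl, hKrect, hKspan⟩ x _ r hr hrH φ hφ
    have hHr := disjoint_closedBall_of_lt_infEDist hrH
    have hspan := hKspan.image_deform hC hKcl hHr hφ
    obtain ⟨M, hM⟩ := hφ.1
    refine ⟨hspan, sInf_le ⟨φ '' K, ⟨hKcl.image_deform hHr hφ, hKrect.image hM, hspan⟩, ?_, rfl⟩⟩
    rw [closure_ball x hr.ne']
    exact image_deform_diff hφ
  exact ⟨fun K hK x hx => ae_of_all _ fun r hr φ hφ => (main K hK x hx r hr.1 hr.2 φ hφ).2, main⟩
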